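/- Let n be even and let C_k be a D-wave configuration of length n on H_n with interrupter set I ⊆ {v_{i,1} : i ∈ ℤ/n}. Then in the 1/2-power index process, C_{k+1} is a C-wave configuration of length n with interrupter set I′ = { v_{i,2} : exactly one of v_{i-1,1} and v_{i+1,1} is contained in I }. -/

import Mathlib

open scoped Classical

/-- A strategy of a voter: collaborator (`C`) or defector (`D`). -/
inductive Strategy : Type
  | C : Strategy
  | D : Strategy
deriving DecidableEq

noncomputable section

variable {V : Type*}

/-- The closed neighbourhood `N[v]` of a vertex, as a finset. -/
def closedNbhd (G : SimpleGraph V) [Fintype V] (v : V) : Finset V :=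
  Finset.univ.filter fun u => u = v ∨ G.Adj u v

/-- The (Shapley–Shubik style) power of a vertex `v` in configuration `c`
with win condition `w`. -/
def power (G : SimpleGraph V) [Fintype V] (w : ℝ) (c : V → Strategy) (v : V) : ℝ :=
  let N := closedNbhd G v
  let nC := (N.filter fun u => c u = Strategy.C).card
  let nD := (N.filter fun u => c u = Strategy.D).card
  match c v with
  | Strategy.C => if w < (nC : ℝ) / (N.card : ℝ) then 1 / (nC : ℝ) else 0
  | Strategy.D => if (nC : ℝ) / (N.card : ℝ) ≤ w then 1 / (nD : ℝ) else 0

/-- One step of the `w`-power index process: every vertex adopts the strategy of a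
vertex of maximum power in its closed neighbourhood, retaining its own strategy if
vertices of maximum power have differing strategies. -/
def step (G : SimpleGraph V) [Fintype V] (w : ℝ) (c : V → Strategy) (v : V) : Strategy :=
  let N := closedNbhd G v
  let M := N.filter fun u => ∀ x ∈ N, power G w c x ≤ power G w c u
  if ∀ u ∈ M, c u = Strategy.C then Strategy.C
  else if ∀ u ∈ M, c u = Strategy.D then Strategy.D
  else c v

/-- `configSeq G w c0 i` is the configuration `C_i` of the `w`-power index process. -/
def configSeq (G : SimpleGraph V) [Fintype V] (w : ℝ) (c0 : V → Strategy) : ℕ → V → Strategy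
  | 0 => c0
  | k + 1 => step G w (configSeq G w c0 k)

/-- The process is eventually stable. -/
def EventuallyStable (G : SimpleGraph V) [Fintype V] (w : ℝ) (c0 : V → Strategy) : Prop :=
  ∃ i, configSeq G w c0 (i + 1) = configSeq G w c0 i

/-- The process reaches a stable all-collaborator configuration. -/
def CollaboratorDominant (G : SimpleGraph V) [Fintype V] (w : ℝ) (c0 : V → Strategy) : Prop :=
  ∃ i, configSeq G w c0 (i + 1) = configSeq G w c0 i ∧
    ∀ v, configSeq G w c0 i v = Strategy.C

/-- The process reaches a stable all-defector configuration. -/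
def DefectorDominant (G : SimpleGraph V) [Fintype V] (w : ℝ) (c0 : V → Strategy) : Prop :=
  ∃ i, configSeq G w c0 (i + 1) = configSeq G w c0 i ∧
    ∀ v, configSeq G w c0 i v = Strategy.D

/-- The process is eventually periodic with period `ℓ`: `ℓ > 1` is the least integer
such that `C_i = C_{i+ℓ}` for some `i ≥ 0`. -/
def EventuallyPeriodicWithPeriod (G : SimpleGraph V) [Fintype V] (w : ℝ)
    (c0 : V → Strategy) (ℓ : ℕ) : Prop :=
  IsLeast {m : ℕ | 1 < m ∧ ∃ i, configSeq G w c0 (i + m) = configSeq G w c0 i} ℓ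

end

/-- Vertices of the graph `H_n`: a pair `(i, (j, t))` where `i ∈ ℤ/n` is the column,
`j ∈ {0, 1}` is the row (row `0` is row "1" of the paper, row `1` is row "2"),
and `t` records the kind of vertex: `t = 0` is `v_{i,j}` (a vertex of `C_n □ P_2`),
`t = 1` is `z_{i,j}` (the triangle vertex joined to `v_{i,j}`), and `t = 2, 3`
are `x_{i,j}, y_{i,j}` (the other two triangle vertices). -/
abbrev HVertex (n : ℕ) : Type := ZMod n × Fin 2 × Fin 4

/-- The graph `H_n`, obtained from `C_n □ P_2` by attaching, to each vertex
`v_{i,j}`, a pendant triangle `x_{i,j} y_{i,j} z_{i,j}` via the edge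
`v_{i,j} z_{i,j}`. -/
def Hgraph (n : ℕ) : SimpleGraph (HVertex n) :=
  SimpleGraph.fromRel fun a b =>
    -- cycle edges of each row: v_{i,j} ~ v_{i+1,j}
    (a.2.2 = 0 ∧ b.2.2 = 0 ∧ a.2.1 = b.2.1 ∧ b.1 = a.1 + 1) ∨
    -- rung edges: v_{i,0} ~ v_{i,1}
    (a.2.2 = 0 ∧ b.2.2 = 0 ∧ a.1 = b.1 ∧ a.2.1 ≠ b.2.1) ∨
    -- triangle edges among x, y, z at the same (i, j)
    (a.1 = b.1 ∧ a.2.1 = b.2.1 ∧ a.2.2 ≠ 0 ∧ b.2.2 ≠ 0) ∨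
    -- pendant edges: v_{i,j} ~ z_{i,j}
    (a.1 = b.1 ∧ a.2.1 = b.2.1 ∧ a.2.2 = 0 ∧ b.2.2 = 1)

/-- The configuration `W` on `H_n`: all vertices of row `0` (the paper's row `1`)
are collaborators, all vertices of row `1` (the paper's row `2`) are defectors. -/
def Wconfig (n : ℕ) : HVertex n → Strategy :=
  fun a => if a.2.1 = 0 then Strategy.C else Strategy.D

noncomputable section

/-- The `C`-wave configuration on `H_n` with interrupter columns `I`: the
configuration `W` with the strategies of the vertices `v_{i,2}` (`i ∈ I`) flipped
from `D` to `C`. -/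
def CwaveConfig (n : ℕ) (I : Set (ZMod n)) : HVertex n → Strategy :=
  fun a => if a.2.1 = 0 then Strategy.C
    else if a.2.2 = 0 ∧ a.1 ∈ I then Strategy.C else Strategy.D

/-- The `D`-wave configuration on `H_n` with interrupter columns `I`: the
configuration `W` with the strategies of the vertices `v_{i,1}` (`i ∈ I`) flipped
from `C` to `D`. -/
def DwaveConfig (n : ℕ) (I : Set (ZMod n)) : HVertex n → Strategy :=
  fun a => if a.2.1 = 0 then
    (if a.2.2 = 0 ∧ a.1 ∈ I then Strategy.D else Strategy.C) else Strategy.D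

/-- A set of interrupter columns is admissible for a wave configuration when all its
columns have the same parity. -/
def SameParity {n : ℕ} (I : Set (ZMod n)) : Prop :=
  ∃ p : ZMod 2, ∀ i ∈ I, ((i.val : ℕ) : ZMod 2) = p

end

section helpers

lemma step_strict {V : Type*} (G : SimpleGraph V) [Fintype V] (w : ℝ) (c : V → Strategy) (v u : V)
    (s : Strategy) (hu : u ∈ closedNbhd G v) (hs : c u = s)
    (h : ∀ x ∈ closedNbhd G v, c x ≠ s → power G w c x < power G w c u) :
    step G w c v = s := by
  have key : ∀ m ∈ (closedNbhd G v).filter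
      (fun u => ∀ x ∈ closedNbhd G v, power G w c x ≤ power G w c u), c m = s := by
    intro m hm
    rw [Finset.mem_filter] at hm
    by_contra hne
    exact absurd (hm.2 u hu) (not_le.2 (h m hm.1 hne))
  obtain ⟨m, hm, hmax⟩ := Finset.exists_max_image (closedNbhd G v) (power G w c) ⟨u, hu⟩
  have hmM : m ∈ (closedNbhd G v).filter
      (fun u => ∀ x ∈ closedNbhd G v, power G w c x ≤ power G w c u) :=
    Finset.mem_filter.2 ⟨hm, hmax⟩
  unfold step
  cases s with
  | C => exact if_pos key
  | D =>
    have h1 : ¬ ∀ m ∈ (closedNbhd G v).filter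
      (fun u => ∀ x ∈ closedNbhd G v, power G w c x ≤ power G w c u), c m = Strategy.C := by
      intro h'
      have := h' m hmM
      rw [key m hmM] at this
      cases this
    exact (if_neg h1).trans (if_pos key)

lemma step_retain {V : Type*} (G : SimpleGraph V) [Fintype V] (w : ℝ) (c : V → Strategy) (v u : V)
    (s : Strategy) (hv : c v = s) (hu : u ∈ closedNbhd G v) (hs : c u = s)
    (h : ∀ x ∈ closedNbhd G v, c x ≠ s → power G w c x ≤ power G w c u) :
    step G w c v = s := by
  obtain ⟨m, hm, hms, hmax⟩ : ∃ m ∈ closedNbhd G v, c m = s ∧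
      ∀ x ∈ closedNbhd G v, power G w c x ≤ power G w c m := by
    obtain ⟨m, hm, hmax⟩ := Finset.exists_max_image (closedNbhd G v) (power G w c) ⟨u, hu⟩
    by_cases hc : c m = s
    · exact ⟨m, hm, hc, hmax⟩
    · exact ⟨u, hu, hs, fun x hx => (hmax x hx).trans (h m hm hc)⟩
  have hmM : m ∈ (closedNbhd G v).filter
      (fun u => ∀ x ∈ closedNbhd G v, power G w c x ≤ power G w c u) :=
    Finset.mem_filter.2 ⟨hm, hmax⟩
  unfold step
  dsimp only
  split_ifs with h1 h2
  · rw [← hms, h1 m hmM]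
  · rw [← hms, h2 m hmM]
  · exact hv

variable (n : ℕ) [NeZero n] (i : ZMod n)

lemma nb_v0 (hn : 3 ≤ n) : closedNbhd (Hgraph n) (i, 0, 0) =
    {(i, 0, 0), (i + 1, 0, 0), (i - 1, 0, 0), (i, 1, 0), (i, 0, 1)} := by
  haveI : Fact (1 < n) := ⟨by omega⟩
  ext ⟨a, j, t⟩
  simp only [closedNbhd, Hgraph, SimpleGraph.fromRel_adj, Finset.mem_filter, Finset.mem_univ,
    true_and, Finset.mem_insert, Finset.mem_singleton, Prod.mk.injEq, ne_eq]
  have e : i = a + 1 ↔ a = i - 1 := by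
    constructor <;> (intro h; rw [h]; ring)
  have h1 : i + 1 ≠ i := by simp
  have h2 : i - 1 ≠ i := by simp
  fin_cases j <;> fin_cases t <;> simp [e] <;> grind

lemma nb_v1 (hn : 3 ≤ n) : closedNbhd (Hgraph n) (i, 1, 0) =
    {(i, 1, 0), (i + 1, 1, 0), (i - 1, 1, 0), (i, 0, 0), (i, 1, 1)} := by
  haveI : Fact (1 < n) := ⟨by omega⟩
  ext ⟨a, j, t⟩
  simp only [closedNbhd, Hgraph, SimpleGraph.fromRel_adj, Finset.mem_filter, Finset.mem_univ,
    true_and, Finset.mem_insert, Finset.mem_singleton, Prod.mk.injEq, ne_eq]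
  have e : i = a + 1 ↔ a = i - 1 := by
    constructor <;> (intro h; rw [h]; ring)
  have h1 : i + 1 ≠ i := by simp
  have h2 : i - 1 ≠ i := by simp
  fin_cases j <;> fin_cases t <;> simp [e] <;> grind

lemma nb_z (j : Fin 2) : closedNbhd (Hgraph n) (i, j, 1) =
    {(i, j, 0), (i, j, 1), (i, j, 2), (i, j, 3)} := by
  ext ⟨a, k, t⟩
  simp only [closedNbhd, Hgraph, SimpleGraph.fromRel_adj, Finset.mem_filter, Finset.mem_univ,
    true_and, Finset.mem_insert, Finset.mem_singleton, Prod.mk.injEq, ne_eq]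
  fin_cases t <;> simp <;> grind

lemma nb_x (j : Fin 2) : closedNbhd (Hgraph n) (i, j, 2) =
    {(i, j, 1), (i, j, 2), (i, j, 3)} := by
  ext ⟨a, k, t⟩
  simp only [closedNbhd, Hgraph, SimpleGraph.fromRel_adj, Finset.mem_filter, Finset.mem_univ,
    true_and, Finset.mem_insert, Finset.mem_singleton, Prod.mk.injEq, ne_eq]
  fin_cases t <;> simp <;> grind

lemma nb_y (j : Fin 2) : closedNbhd (Hgraph n) (i, j, 3) =
    {(i, j, 1), (i, j, 2), (i, j, 3)} := by
  ext ⟨a, k, t⟩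
  simp only [closedNbhd, Hgraph, SimpleGraph.fromRel_adj, Finset.mem_filter, Finset.mem_univ,
    true_and, Finset.mem_insert, Finset.mem_singleton, Prod.mk.injEq, ne_eq]
  fin_cases t <;> simp <;> grind

variable (I : Set (ZMod n))

lemma c_row1 (t : Fin 4) : DwaveConfig n I (i, 1, t) = Strategy.D := by simp [DwaveConfig]
lemma c_row0 (t : Fin 4) (ht : t ≠ 0) : DwaveConfig n I (i, 0, t) = Strategy.C := by
  simp [DwaveConfig, ht]
lemma c_in (h : i ∈ I) : DwaveConfig n I (i, 0, 0) = Strategy.D := by simp [DwaveConfig, h]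
lemma c_out (h : i ∉ I) : DwaveConfig n I (i, 0, 0) = Strategy.C := by simp [DwaveConfig, h]

/-- distinctness of the columns `i-1`, `i`, `i+1` -/
lemma cols (hn : 3 ≤ n) : i + 1 ≠ i ∧ i - 1 ≠ i ∧ i + 1 ≠ i - 1 := by
  haveI : Fact (1 < n) := ⟨by omega⟩
  refine ⟨by simp, by simp, fun h => ?_⟩
  have h2 : ((2 : ℕ) : ZMod n) = 0 := by
    push_cast
    linear_combination h
  rw [ZMod.natCast_eq_zero_iff] at h2
  exact absurd (Nat.le_of_dvd (by norm_num) h2) (by omega)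

lemma p_v1_le (hn : 3 ≤ n) : power (Hgraph n) (1 / 2) (DwaveConfig n I) (i, 1, 0) ≤ 1 / 4 := by
  obtain ⟨h1, h2, h3⟩ := cols n i hn
  by_cases h : i ∈ I <;>
  simp [power, nb_v1 n i hn, c_row1, c_in, c_out, h, Finset.filter_insert, Finset.filter_singleton,
    h1, h2, h3, h1.symm, h2.symm, h3.symm] <;> norm_num

lemma p_v1_in (hn : 3 ≤ n) (h : i ∈ I) :
    power (Hgraph n) (1 / 2) (DwaveConfig n I) (i, 1, 0) = 1 / 5 := by
  obtain ⟨h1, h2, h3⟩ := cols n i hn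
  simp [power, nb_v1 n i hn, c_row1, c_in, h, Finset.filter_insert, Finset.filter_singleton,
    h1, h2, h3, h1.symm, h2.symm, h3.symm]

lemma p_z1 : power (Hgraph n) (1 / 2) (DwaveConfig n I) (i, 1, 1) = 1 / 4 := by
  simp [power, nb_z, c_row1, Finset.filter_insert, Finset.filter_singleton]

lemma p_z0_in (h : i ∈ I) : power (Hgraph n) (1 / 2) (DwaveConfig n I) (i, 0, 1) = 1 / 3 := by
  simp [power, nb_z, c_row0, c_in, h, Finset.filter_insert, Finset.filter_singleton]
  norm_num

lemma p_z0_out (h : i ∉ I) : power (Hgraph n) (1 / 2) (DwaveConfig n I) (i, 0, 1) = 1 / 4 := by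
  simp [power, nb_z, c_row0, c_out, h, Finset.filter_insert, Finset.filter_singleton]
  norm_num

lemma p_v0_in (hn : 3 ≤ n) (h : i ∈ I) (hp : i + 1 ∉ I) (hm : i - 1 ∉ I) :
    power (Hgraph n) (1 / 2) (DwaveConfig n I) (i, 0, 0) = 0 := by
  obtain ⟨h1, h2, h3⟩ := cols n i hn
  simp [power, nb_v0 n i hn, c_row1, c_row0, c_in, c_out, h, hp, hm, Finset.filter_insert,
    Finset.filter_singleton, h1, h2, h3, h1.symm, h2.symm, h3.symm]
  norm_num

lemma p_v0_out1 (hn : 3 ≤ n) (h : i ∉ I) (hx : Xor' (i - 1 ∈ I) (i + 1 ∈ I)) :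
    power (Hgraph n) (1 / 2) (DwaveConfig n I) (i, 0, 0) = 1 / 3 := by
  obtain ⟨h1, h2, h3⟩ := cols n i hn
  rcases hx with ⟨hm, hp⟩ | ⟨hp, hm⟩ <;>
  simp [power, nb_v0 n i hn, c_row1, c_row0, c_in, c_out, h, hp, hm, Finset.filter_insert,
    Finset.filter_singleton, h1, h2, h3, h1.symm, h2.symm, h3.symm] <;>
  norm_num

lemma p_v0_out2 (hn : 3 ≤ n) (h : i ∉ I) (hx : ¬ Xor' (i - 1 ∈ I) (i + 1 ∈ I)) :
    power (Hgraph n) (1 / 2) (DwaveConfig n I) (i, 0, 0) ≤ 1 / 4 := by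
  obtain ⟨h1, h2, h3⟩ := cols n i hn
  by_cases hm : i - 1 ∈ I <;> by_cases hp : i + 1 ∈ I <;> simp [Xor', hm, hp] at hx <;>
  simp [power, nb_v0 n i hn, c_row1, c_row0, c_in, c_out, h, hp, hm, Finset.filter_insert,
    Finset.filter_singleton, h1, h2, h3, h1.symm, h2.symm, h3.symm] <;>
  norm_num

lemma parity_next (hev : Even n) (hI : SameParity I) (h : i ∈ I) : i + 1 ∉ I ∧ i - 1 ∉ I := by
  have hd : 2 ∣ n := hev.two_dvd
  obtain ⟨p, hp⟩ := hI
  have hp' : ∀ a ∈ I, ZMod.castHom hd (ZMod 2) a = p := by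
    intro a ha
    rw [← hp a ha, ← map_natCast (ZMod.castHom hd (ZMod 2)), ZMod.natCast_zmod_val]
  have h0 := hp' i h
  constructor
  · intro h'
    have := hp' _ h'
    rw [map_add, map_one, h0] at this
    simp at this
  · intro h'
    have := hp' _ h'
    rw [map_sub, map_one, h0] at this
    simp at this

end helpers

/-- Let `n ≥ 3` be even and let `C_k` be a `D`-wave configuration
of length `n` on `H_n` with interrupter columns `I` (all of the same parity). Then
the next configuration of the `1/2`-power index process is the `C`-wave
configuration whose interrupters are the vertices `v_{i,2}` such that exactly one of
`v_{i-1,1}` and `v_{i+1,1}` is an interrupter of `C_k`. -/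
theorem statement11 (n : ℕ) [NeZero n] (hn : 3 ≤ n) (hev : Even n)
    (I : Set (ZMod n)) (hI : SameParity I) :
    step (Hgraph n) (1 / 2) (DwaveConfig n I) =
      CwaveConfig n {i : ZMod n | Xor' ((i - 1) ∈ I) ((i + 1) ∈ I)} := by
  have par := fun i => parity_next n i I hev hI
  have memself : ∀ v, v ∈ closedNbhd (Hgraph n) v := fun v => by simp [closedNbhd]
  have p0 : ∀ i ∈ I, power (Hgraph n) (1 / 2) (DwaveConfig n I) (i, 0, 0) = 0 :=
    fun i h => p_v0_in n i I hn h (par i h).1 (par i h).2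
  funext ⟨i, j, t⟩
  have hj : j = 0 ∨ j = 1 := by omega
  have ht : t = 0 ∨ t = 1 ∨ t = 2 ∨ t = 3 := by omega
  rcases hj with rfl | rfl
  · -- row 0: everybody ends up a collaborator
    have hC : CwaveConfig n {i : ZMod n | Xor' ((i - 1) ∈ I) ((i + 1) ∈ I)} (i, 0, t)
        = Strategy.C := by simp [CwaveConfig]
    rw [hC]
    rcases ht with rfl | rfl | rfl | rfl
    · by_cases h : i ∈ I
      · refine step_strict _ _ _ _ (i, 0, 1) _ (by rw [nb_v0 n i hn]; simp)
          (c_row0 _ _ _ _ (by decide)) ?_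
        rw [p_z0_in n i I h, nb_v0 n i hn]
        intro x hx hne
        simp only [Finset.mem_insert, Finset.mem_singleton] at hx
        rcases hx with rfl | rfl | rfl | rfl | rfl
        · rw [p0 i h]; norm_num
        · exact absurd (c_out _ _ _ (par i h).1) hne
        · exact absurd (c_out _ _ _ (par i h).2) hne
        · rw [p_v1_in n i I hn h]; norm_num
        · exact absurd (c_row0 _ _ _ _ (by decide)) hne
      · refine step_retain _ _ _ _ (i, 0, 1) _ (c_out _ _ _ h) (by rw [nb_v0 n i hn]; simp)
          (c_row0 _ _ _ _ (by decide)) ?_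
        rw [p_z0_out n i I h, nb_v0 n i hn]
        have side : ∀ k, DwaveConfig n I (k, 0, 0) ≠ Strategy.C →
            power (Hgraph n) (1 / 2) (DwaveConfig n I) (k, 0, 0) ≤ 1 / 4 := by
          intro k hk
          by_cases hkI : k ∈ I
          · rw [p0 k hkI]; norm_num
          · exact absurd (c_out _ _ _ hkI) hk
        intro x hx hne
        simp only [Finset.mem_insert, Finset.mem_singleton] at hx
        rcases hx with rfl | rfl | rfl | rfl | rfl
        · exact side _ hne
        · exact side _ hne
        · exact side _ hne
        · exact p_v1_le n i I hn
        · exact absurd (c_row0 _ _ _ _ (by decide)) hne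
    · refine step_strict _ _ _ _ (i, 0, 1) _ (memself _) (c_row0 _ _ _ _ (by decide)) ?_
      rw [nb_z n i]
      intro x hx hne
      simp only [Finset.mem_insert, Finset.mem_singleton] at hx
      rcases hx with rfl | rfl | rfl | rfl
      · by_cases h : i ∈ I
        · rw [p0 i h, p_z0_in n i I h]; norm_num
        · exact absurd (c_out _ _ _ h) hne
      all_goals exact absurd (c_row0 _ _ _ _ (by decide)) hne
    · refine step_strict _ _ _ _ _ _ (memself _) (c_row0 _ _ _ _ (by decide)) ?_
      rw [nb_x n i]
      intro x hx hne
      simp only [Finset.mem_insert, Finset.mem_singleton] at hx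
      rcases hx with rfl | rfl | rfl
      all_goals exact absurd (c_row0 _ _ _ _ (by decide)) hne
    · refine step_strict _ _ _ _ _ _ (memself _) (c_row0 _ _ _ _ (by decide)) ?_
      rw [nb_y n i]
      intro x hx hne
      simp only [Finset.mem_insert, Finset.mem_singleton] at hx
      rcases hx with rfl | rfl | rfl
      all_goals exact absurd (c_row0 _ _ _ _ (by decide)) hne
  · rcases ht with rfl | rfl | rfl | rfl
    · by_cases hx : Xor' (i - 1 ∈ I) (i + 1 ∈ I)
      · have hC : CwaveConfig n {i : ZMod n | Xor' ((i - 1) ∈ I) ((i + 1) ∈ I)} (i, 1, 0)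
            = Strategy.C := by simp [CwaveConfig, hx]
        rw [hC]
        have h : i ∉ I := by
          intro h
          rcases hx with ⟨h', _⟩ | ⟨h', _⟩
          · exact (par i h).2 h'
          · exact (par i h).1 h'
        refine step_strict _ _ _ _ (i, 0, 0) _ (by rw [nb_v1 n i hn]; simp) (c_out _ _ _ h) ?_
        rw [p_v0_out1 n i I hn h hx, nb_v1 n i hn]
        intro x hx hne
        simp only [Finset.mem_insert, Finset.mem_singleton] at hx
        rcases hx with rfl | rfl | rfl | rfl | rfl
        · exact (p_v1_le n _ I hn).trans_lt (by norm_num)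
        · exact (p_v1_le n _ I hn).trans_lt (by norm_num)
        · exact (p_v1_le n _ I hn).trans_lt (by norm_num)
        · exact absurd (c_out _ _ _ h) hne
        · rw [p_z1]; norm_num
      · have hD : CwaveConfig n {i : ZMod n | Xor' ((i - 1) ∈ I) ((i + 1) ∈ I)} (i, 1, 0)
            = Strategy.D := by simp [CwaveConfig, hx]
        rw [hD]
        refine step_retain _ _ _ _ (i, 1, 1) _ (c_row1 _ _ _ _) (by rw [nb_v1 n i hn]; simp)
          (c_row1 _ _ _ _) ?_
        rw [p_z1, nb_v1 n i hn]
        intro x hx' hne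
        simp only [Finset.mem_insert, Finset.mem_singleton] at hx'
        rcases hx' with rfl | rfl | rfl | rfl | rfl
        · exact absurd (c_row1 _ _ _ _) hne
        · exact absurd (c_row1 _ _ _ _) hne
        · exact absurd (c_row1 _ _ _ _) hne
        · by_cases h : i ∈ I
          · exact absurd (c_in _ _ _ h) hne
          · exact p_v0_out2 n i I hn h hx
        · exact absurd (c_row1 _ _ _ _) hne
    all_goals
      refine (step_strict _ _ _ _ _ Strategy.D (memself _) (c_row1 _ _ _ _) ?_).trans
        (by simp [CwaveConfig])
      simp only [nb_z n i, nb_x n i, nb_y n i]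
      intro x hx hne
      simp only [Finset.mem_insert, Finset.mem_singleton] at hx
      exfalso
      apply hne
      rcases hx with rfl | hx
      · exact c_row1 _ _ _ _
      rcases hx with rfl | hx
      · exact c_row1 _ _ _ _
      first
        | (rcases hx with rfl | rfl <;> exact c_row1 _ _ _ _)
        | (subst hx; exact c_row1 _ _ _ _)
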